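/- arXiv:2504.09126 — 2 statements merged into one kernel-verified Lean document; each statement's English description precedes it below -/
import Mathlib

section
/- The code C over E is Hermitian LCD if and only if all of the following four conditions hold: (I) g is self-conjugate-reciprocal; (II) l is self-conjugate-reciprocal; (III) gcd(t22(x), g12(x)) = 1; (IV) gcd(r22(x), g11(x)·ĝ11(x) + g12(x)·ĝ12(x)) = 1. -/
open Polynomial

noncomputable section

/-- The coefficient vector (of length `m`) of the canonical representative of an
element of `R = F[x]/(x^m - 1)`.  Under the identification of `R²` with `F^{2m}` a pair
`(a(x), b(x))` corresponds to the concatenation of the two coefficient vectors. -/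
def qcToVec {F : Type} [Field F] {m : ℕ} (hm : 0 < m)
    (a : AdjoinRoot (X ^ m - 1 : F[X])) : Fin m → F := fun i =>
  (AdjoinRoot.modByMonicHom
    (show (X ^ m - 1 : F[X]).Monic by
      simpa using monic_X_pow_sub_C (1 : F) hm.ne') a).coeff i

/-- The Hermitian inner product `⟨u,v⟩_h = Σ u_i v_i^q` on `R × R`, via the identification
of `R²` with `E^{2m}` by coefficient vectors. -/
def qcHermInner {E : Type} [Field E] (q : ℕ) {m : ℕ} (hm : 0 < m)
    (u v : AdjoinRoot (X ^ m - 1 : E[X]) × AdjoinRoot (X ^ m - 1 : E[X])) : E :=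
  (∑ i, qcToVec hm u.1 i * (qcToVec hm v.1 i) ^ q) +
    ∑ i, qcToVec hm u.2 i * (qcToVec hm v.2 i) ^ q

/-- A code `C ⊆ R²` is LCD with respect to a pairing `inner` if it meets its dual
trivially, i.e. `C ∩ C^⊥ = {0}` where `C^⊥ = {v : ∀ c ∈ C, inner c v = 0}`. -/
def IsLCDWith {F : Type} [Field F] {m : ℕ}
    (Cd : Submodule (AdjoinRoot (X ^ m - 1 : F[X]))
      (AdjoinRoot (X ^ m - 1 : F[X]) × AdjoinRoot (X ^ m - 1 : F[X])))
    (inner : (AdjoinRoot (X ^ m - 1 : F[X]) × AdjoinRoot (X ^ m - 1 : F[X])) →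
      (AdjoinRoot (X ^ m - 1 : F[X]) × AdjoinRoot (X ^ m - 1 : F[X])) → F) : Prop :=
  ∀ v ∈ Cd, (∀ c ∈ Cd, inner c v = 0) → v = 0

/-- The conjugate polynomial `f^[q]`, obtained by applying `a ↦ a^q` to each coefficient. -/
def conjPoly {E : Type} [Field E] (q : ℕ) (f : E[X]) : E[X] :=
  f.sum fun n a => Polynomial.C (a ^ q) * X ^ n

/-- The conjugate-reciprocal polynomial `f†(x) = x^(deg f)·f^[q](1/x)`. -/
def conjReciprocal {E : Type} [Field E] (q : ℕ) (f : E[X]) : E[X] :=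
  (conjPoly q f).reflect f.natDegree

/-- `f` is self-conjugate-reciprocal: `f† = α·f` for some nonzero scalar `α`. -/
def IsSelfConjReciprocal {E : Type} [Field E] (q : ℕ) (f : E[X]) : Prop :=
  ∃ α : E, α ≠ 0 ∧ conjReciprocal q f = Polynomial.C α * f

section Roots

variable {E K : Type*} [Field E] [Field K] [Algebra E K]

theorem aeval_gcd_eq_zero_iff [DecidableEq E] (f h : E[X]) (x : K) :
    aeval x (gcd f h) = 0 ↔ aeval x f = 0 ∧ aeval x h = 0 := by
  constructor
  · intro hx
    obtain ⟨a, ha⟩ := gcd_dvd_left f h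
    obtain ⟨b, hb⟩ := gcd_dvd_right f h
    exact ⟨by rw [ha, map_mul, hx, zero_mul], by rw [hb, map_mul, hx, zero_mul]⟩
  · rintro ⟨hf, hh⟩
    obtain ⟨a, b, hab⟩ := exists_gcd_eq_mul_add_mul f h
    rw [hab]
    simp [hf, hh]

theorem aeval_lcm_eq_zero_iff [DecidableEq E] (f h : E[X]) (x : K) :
    aeval x (lcm f h) = 0 ↔ aeval x f = 0 ∨ aeval x h = 0 := by
  constructor
  · intro hx
    obtain ⟨c, hc⟩ := lcm_dvd (dvd_mul_right f h) (dvd_mul_left h f)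
    have : aeval x (f * h) = 0 := by rw [hc, map_mul, hx, zero_mul]
    simpa using this
  · rintro (hx | hx)
    · obtain ⟨c, hc⟩ := dvd_lcm_left f h
      rw [hc, map_mul, hx, zero_mul]
    · obtain ⟨c, hc⟩ := dvd_lcm_right f h
      rw [hc, map_mul, hx, zero_mul]

theorem Polynomial.Separable.aeval_div_eq_zero_iff {f d : E[X]} (hf : f.Separable) (hd : d ∣ f)
    (x : K) : aeval x (f / d) = 0 ↔ aeval x f = 0 ∧ aeval x d ≠ 0 := by
  have hd0 : d ≠ 0 := ne_zero_of_dvd_ne_zero hf.ne_zero hd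
  have hmul : d * (f / d) = f := EuclideanDomain.mul_div_cancel' hd0 hd
  have hcop : IsCoprime d (f / d) := Separable.isCoprime (hmul.symm ▸ hf)
  obtain ⟨a, b, hab⟩ := hcop
  have h1 := congrArg (aeval x) hab
  have h2 := congrArg (aeval x) hmul
  simp only [map_add, map_mul, map_one] at h1 h2
  constructor
  · intro h
    refine ⟨by rw [← h2, h, mul_zero], fun h' => ?_⟩
    simp [h, h'] at h1
  · rintro ⟨h, h'⟩
    rw [h] at h2
    exact (mul_eq_zero.mp h2).resolve_left h'

theorem Polynomial.Separable.dvd_of_forall_aeval_eq_zero [IsAlgClosed K] {f h : E[X]}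
    (hf : f.Separable) (H : ∀ x : K, aeval x f = 0 → aeval x h = 0) : f ∣ h := by
  classical
  have hd := gcd_dvd_left f h
  have hd0 : gcd f h ≠ 0 := ne_zero_of_dvd_ne_zero hf.ne_zero hd
  have hmul : gcd f h * (f / gcd f h) = f := EuclideanDomain.mul_div_cancel' hd0 hd
  have hunit : IsUnit (f / gcd f h) := by
    rw [← isCoprime_zero_right, isCoprime_iff_aeval_ne_zero_of_isAlgClosed E K]
    intro x
    left
    rw [Ne, hf.aeval_div_eq_zero_iff hd]
    rintro ⟨h1, h2⟩
    exact h2 ((aeval_gcd_eq_zero_iff f h x).2 ⟨h1, H x h1⟩)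
  have hdvd : f ∣ gcd f h := by
    conv_lhs => rw [← hmul]
    exact hunit.mul_right_dvd.mpr dvd_rfl
  exact hdvd.trans (gcd_dvd_right f h)

end Roots

section Conjugation

variable {E K : Type} [Field E] [Field K] [Algebra E K] {q : ℕ}

theorem conjPoly_eq_map (σ : E →+* E) (hσ : ∀ a, σ a = a ^ q) (f : E[X]) :
    conjPoly q f = f.map σ := by
  rw [conjPoly, Polynomial.map, eval₂_eq_sum]
  simp [hσ, Polynomial.sum]

theorem aeval_pow_conjPoly (σ : E →+* E) (hσ : ∀ a, σ a = a ^ q)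
    (φ : K →+* K) (hφ : ∀ x, φ x = x ^ q) (f : E[X]) (x : K) :
    aeval (x ^ q) (conjPoly q f) = aeval x f ^ q := by
  rw [conjPoly_eq_map σ hσ, ← hφ, ← hφ, aeval_def, aeval_def, eval₂_map, hom_eval₂]
  congr 1
  ext a
  simp [hσ, hφ]

theorem conjPoly_conjPoly (σ : E →+* E) (hσ : ∀ a, σ a = a ^ q) (hE : ∀ a : E, a ^ q ^ 2 = a)
    (f : E[X]) : conjPoly q (conjPoly q f) = f := by
  rw [conjPoly_eq_map σ hσ, conjPoly_eq_map σ hσ, map_map]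
  ext n
  simp [hσ, ← pow_mul, ← sq, hE]

theorem aeval_reflect {N : ℕ} {f : E[X]} (hf : f.natDegree ≤ N) {x : K} (hx : x ≠ 0) :
    aeval x (f.reflect N) = x ^ N * aeval x⁻¹ f := by
  let := invertibleOfNonzero (inv_ne_zero hx)
  have h := eval₂_reflect_mul_pow (algebraMap E K) x⁻¹ N f hf
  rw [invOf_eq_inv, inv_inv] at h
  rw [aeval_def, aeval_def, ← h, mul_left_comm, ← mul_pow, mul_inv_cancel₀ hx, one_pow, mul_one]

theorem natDegree_conjPoly (σ : E →+* E) (hσ : ∀ a, σ a = a ^ q) (f : E[X]) :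
    (conjPoly q f).natDegree = f.natDegree := by
  rw [conjPoly_eq_map σ hσ, natDegree_map]

end Conjugation

section HermitianForm

variable {E : Type} [Field E] {m : ℕ}

theorem monic_X_pow_sub_one (hm : 0 < m) : (X ^ m - 1 : E[X]).Monic := by
  simpa using monic_X_pow_sub_C (1 : E) hm.ne'

theorem natDegree_X_pow_sub_one : (X ^ m - 1 : E[X]).natDegree = m := by
  simpa using natDegree_X_pow_sub_C (n := m) (r := (1 : E))

theorem root_pow_eq_one : AdjoinRoot.root (X ^ m - 1 : E[X]) ^ m = 1 := by
  have h := AdjoinRoot.mk_self (f := (X ^ m - 1 : E[X]))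
  rw [map_sub, map_pow, AdjoinRoot.mk_X, map_one] at h
  exact sub_eq_zero.mp h

theorem qcToVec_add (hm : 0 < m) (a b : AdjoinRoot (X ^ m - 1 : E[X])) (i : Fin m) :
    qcToVec hm (a + b) i = qcToVec hm a i + qcToVec hm b i := by
  simp [qcToVec]

theorem qcToVec_smul (hm : 0 < m) (c : E) (a : AdjoinRoot (X ^ m - 1 : E[X])) (i : Fin m) :
    qcToVec hm (c • a) i = c * qcToVec hm a i := by
  simp [qcToVec]

theorem qcToVec_sum {ι : Type*} (hm : 0 < m) (s : Finset ι)
    (a : ι → AdjoinRoot (X ^ m - 1 : E[X])) (i : Fin m) :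
    qcToVec hm (∑ j ∈ s, a j) i = ∑ j ∈ s, qcToVec hm (a j) i := by
  simp [qcToVec]

theorem qcToVec_root_pow (hm : 0 < m) (n : ℕ) (i : Fin m) :
    qcToVec hm (AdjoinRoot.root (X ^ m - 1 : E[X]) ^ n) i = if n % m = i then 1 else 0 := by
  have hn : AdjoinRoot.root (X ^ m - 1 : E[X]) ^ n
      = AdjoinRoot.mk (X ^ m - 1 : E[X]) (X ^ (n % m)) := by
    rw [map_pow, AdjoinRoot.mk_X]
    exact pow_eq_pow_mod n root_pow_eq_one
  rw [hn, qcToVec, AdjoinRoot.modByMonicHom_mk, (modByMonic_eq_self_iff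
    (monic_X_pow_sub_one hm)).2, coeff_X_pow]
  · simp only [eq_comm]
  · rw [degree_X_pow, degree_eq_natDegree (monic_X_pow_sub_one hm).ne_zero,
      natDegree_X_pow_sub_one]
    exact_mod_cast Nat.mod_lt n hm

theorem natDegree_modByMonicHom_lt (hm : 0 < m) (a : AdjoinRoot (X ^ m - 1 : E[X])) :
    (AdjoinRoot.modByMonicHom (monic_X_pow_sub_one (E := E) hm) a).natDegree < m := by
  obtain ⟨p, rfl⟩ := AdjoinRoot.mk_surjective a
  rw [AdjoinRoot.modByMonicHom_mk]
  have hdeg := natDegree_X_pow_sub_one (E := E) (m := m)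
  have hlt := natDegree_modByMonic_lt p (monic_X_pow_sub_one (E := E) hm) fun h1 => by
    rw [h1, natDegree_one] at hdeg
    omega
  rwa [hdeg] at hlt

theorem eq_sum_qcToVec (hm : 0 < m) (a : AdjoinRoot (X ^ m - 1 : E[X])) :
    a = ∑ i, qcToVec hm a i • AdjoinRoot.root (X ^ m - 1 : E[X]) ^ (i : ℕ) := by
  have h := AdjoinRoot.mk_leftInverse (monic_X_pow_sub_one (E := E) hm) a
  have hdeg := natDegree_modByMonicHom_lt hm a
  conv_lhs => rw [← h, as_sum_range' _ m hdeg, map_sum, Finset.sum_range]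
  refine Finset.sum_congr rfl fun i _ => ?_
  rw [← C_mul_X_pow_eq_monomial, map_mul, map_pow, AdjoinRoot.mk_X, AdjoinRoot.mk_C,
    Algebra.smul_def]
  rfl

theorem qcToVec_eq_qcToVec_zero (hm : 0 < m) (a : AdjoinRoot (X ^ m - 1 : E[X])) (i : Fin m) :
    qcToVec hm (a * AdjoinRoot.root (X ^ m - 1 : E[X]) ^ ((m - 1) * i)) ⟨0, hm⟩
      = qcToVec hm a i := by
  conv_lhs => rw [eq_sum_qcToVec hm a, Finset.sum_mul, qcToVec_sum]
  rw [Finset.sum_eq_single i]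
  · rw [smul_mul_assoc, qcToVec_smul, ← pow_add, qcToVec_root_pow, if_pos, mul_one]
    obtain ⟨k, rfl⟩ : ∃ k, m = k + 1 := ⟨m - 1, by omega⟩
    rw [show (i : ℕ) + (k + 1 - 1) * i = (k + 1) * i by simp; ring]
    simp
  · intro j _ hj
    rw [smul_mul_assoc, qcToVec_smul, ← pow_add, qcToVec_root_pow, if_neg, mul_zero]
    intro h0
    apply hj
    have h1 : m ∣ j + (m - 1) * i := Nat.dvd_of_mod_eq_zero h0
    have h2 : (i : ℕ) + (j + (m - 1) * i) = j + m * i := by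
      obtain ⟨k, rfl⟩ : ∃ k, m = k + 1 := ⟨m - 1, by omega⟩
      simp; ring
    have h3 : (i : ℕ) ≡ j [MOD m] := by
      have h4 : (i : ℕ) + (j + (m - 1) * i) ≡ i + 0 [MOD m] :=
        Nat.ModEq.add_left _ ((Nat.modEq_zero_iff_dvd).2 h1)
      rw [h2] at h4
      have h5 : (j : ℕ) + m * i ≡ j + 0 [MOD m] :=
        Nat.ModEq.add_left _ ((Nat.modEq_zero_iff_dvd).2 (dvd_mul_right m i))
      exact h4.symm.trans h5
    exact Fin.ext (Nat.ModEq.eq_of_lt_of_lt h3 i.2 j.2).symm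
  · simp

/-- The conjugate `f^[q](x^(m-1))`, which represents `f^[q](1/x)` modulo `x^m - 1`. -/
def cyclicConj (q m : ℕ) (f : E[X]) : E[X] :=
  (conjPoly q f).comp (X ^ (m - 1))

theorem mk_cyclicConj_modByMonicHom {q : ℕ} (σ : E →+* E) (hσ : ∀ a, σ a = a ^ q) (hm : 0 < m)
    (v : AdjoinRoot (X ^ m - 1 : E[X])) :
    AdjoinRoot.mk (X ^ m - 1 : E[X])
        (cyclicConj q m (AdjoinRoot.modByMonicHom (monic_X_pow_sub_one (E := E) hm) v))
      = ∑ i, qcToVec hm v i ^ q • AdjoinRoot.root (X ^ m - 1 : E[X]) ^ ((m - 1) * i) := by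
  have hdeg := natDegree_modByMonicHom_lt hm v
  conv_lhs => rw [cyclicConj, conjPoly_eq_map σ hσ, as_sum_range' _ m hdeg]
  rw [Polynomial.map_sum, Finset.sum_range, Polynomial.sum_comp, map_sum]
  refine Finset.sum_congr rfl fun i _ => ?_
  rw [← C_mul_X_pow_eq_monomial, Polynomial.map_mul, Polynomial.map_pow, map_X, map_C, mul_comp,
    C_comp, X_pow_comp, map_mul, map_pow, map_pow, AdjoinRoot.mk_X, AdjoinRoot.mk_C,
    Algebra.smul_def, hσ, ← pow_mul]
  rfl

theorem sum_qcToVec_mul_pow {q : ℕ} (σ : E →+* E) (hσ : ∀ a, σ a = a ^ q) (hm : 0 < m)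
    (u v : AdjoinRoot (X ^ m - 1 : E[X])) :
    ∑ i, qcToVec hm u i * qcToVec hm v i ^ q = qcToVec hm (u * AdjoinRoot.mk (X ^ m - 1 : E[X])
        (cyclicConj q m (AdjoinRoot.modByMonicHom (monic_X_pow_sub_one (E := E) hm) v)))
        ⟨0, hm⟩ := by
  rw [mk_cyclicConj_modByMonicHom σ hσ hm, Finset.mul_sum, qcToVec_sum]
  refine Finset.sum_congr rfl fun i _ => ?_
  rw [mul_smul_comm, qcToVec_smul, qcToVec_eq_qcToVec_zero, mul_comm]

theorem eq_zero_of_forall_qcToVec_mul (hm : 0 < m) (w : AdjoinRoot (X ^ m - 1 : E[X]))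
    (h : ∀ a, qcToVec hm (a * w) ⟨0, hm⟩ = 0) : w = 0 := by
  rw [eq_sum_qcToVec hm w]
  refine Finset.sum_eq_zero fun i _ => ?_
  rw [← qcToVec_eq_qcToVec_zero hm w i, mul_comm w, h, zero_smul]

end HermitianForm

section Duality

variable {E : Type} [Field E] {q m : ℕ}

theorem qcHermInner_eq (σ : E →+* E) (hσ : ∀ a, σ a = a ^ q) (hm : 0 < m)
    (u v : AdjoinRoot (X ^ m - 1 : E[X]) × AdjoinRoot (X ^ m - 1 : E[X])) :
    qcHermInner q hm u v = qcToVec hm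
      (u.1 * AdjoinRoot.mk (X ^ m - 1 : E[X])
        (cyclicConj q m (AdjoinRoot.modByMonicHom (monic_X_pow_sub_one (E := E) hm) v.1)) +
      u.2 * AdjoinRoot.mk (X ^ m - 1 : E[X])
        (cyclicConj q m (AdjoinRoot.modByMonicHom (monic_X_pow_sub_one (E := E) hm) v.2)))
      ⟨0, hm⟩ := by
  rw [qcHermInner, sum_qcToVec_mul_pow σ hσ, sum_qcToVec_mul_pow σ hσ, qcToVec_add]

theorem forall_mem_span_pair_qcHermInner_eq_zero_iff (σ : E →+* E) (hσ : ∀ a, σ a = a ^ q)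
    (hm : 0 < m) (c d v : AdjoinRoot (X ^ m - 1 : E[X]) × AdjoinRoot (X ^ m - 1 : E[X])) :
    (∀ u ∈ Submodule.span (AdjoinRoot (X ^ m - 1 : E[X])) {c, d}, qcHermInner q hm u v = 0) ↔
      ∀ u ∈ ({c, d} : Set _), u.1 * AdjoinRoot.mk (X ^ m - 1 : E[X])
        (cyclicConj q m (AdjoinRoot.modByMonicHom (monic_X_pow_sub_one (E := E) hm) v.1)) +
      u.2 * AdjoinRoot.mk (X ^ m - 1 : E[X])
        (cyclicConj q m (AdjoinRoot.modByMonicHom (monic_X_pow_sub_one (E := E) hm) v.2)) = 0 := by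
  simp only [qcHermInner_eq σ hσ hm]
  generalize AdjoinRoot.mk (X ^ m - 1 : E[X])
    (cyclicConj q m (AdjoinRoot.modByMonicHom (monic_X_pow_sub_one (E := E) hm) v.1)) = w₁
  generalize AdjoinRoot.mk (X ^ m - 1 : E[X])
    (cyclicConj q m (AdjoinRoot.modByMonicHom (monic_X_pow_sub_one (E := E) hm) v.2)) = w₂
  constructor
  · intro h u hu
    refine eq_zero_of_forall_qcToVec_mul hm _ fun a => ?_
    rw [← h (a • u) (Submodule.smul_mem _ a (Submodule.subset_span hu))]
    congr 1
    simp only [Prod.smul_fst, Prod.smul_snd, smul_eq_mul]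
    ring
  · intro h u hu
    have h0 : u.1 * w₁ + u.2 * w₂ = 0 := by
      induction hu using Submodule.span_induction with
      | mem u hu => exact h u hu
      | zero => simp
      | add u u' _ _ hu hu' =>
        simp only [Prod.fst_add, Prod.snd_add]
        linear_combination hu + hu'
      | smul a u _ hu =>
        simp only [Prod.smul_fst, Prod.smul_snd, smul_eq_mul]
        linear_combination a * hu
    rw [h0]
    simp [qcToVec]

variable {K : Type} [Field K] [Algebra E K]

theorem ne_zero_of_pow_eq_one (hm : 0 < m) {x : K} (hx : x ^ m = 1) : x ≠ 0 := by
  rintro rfl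
  simp [hm.ne'] at hx

theorem aeval_X_pow_sub_one_eq_zero_iff (x : K) :
    aeval x (X ^ m - 1 : E[X]) = 0 ↔ x ^ m = 1 := by
  simp [sub_eq_zero]

theorem inv_pow_pow_eq_one {x : K} (hx : x ^ m = 1) : (x ^ q)⁻¹ ^ m = 1 := by
  rw [inv_pow, ← pow_mul, mul_comm, pow_mul, hx, one_pow, inv_one]

theorem mk_X_pow_sub_one_eq_zero_iff [IsAlgClosed K] (hsep : (X ^ m - 1 : E[X]).Separable)
    (f : E[X]) : AdjoinRoot.mk (X ^ m - 1 : E[X]) f = 0 ↔ ∀ x : K, x ^ m = 1 → aeval x f = 0 := by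
  rw [AdjoinRoot.mk_eq_zero]
  constructor
  · rintro ⟨c, rfl⟩ x hx
    rw [map_mul, (aeval_X_pow_sub_one_eq_zero_iff x).2 hx, zero_mul]
  · intro h
    exact hsep.dvd_of_forall_aeval_eq_zero
      fun x hx => h x ((aeval_X_pow_sub_one_eq_zero_iff x).1 hx)

theorem aeval_cyclicConj (hm : 0 < m) {x : K} (hx : x ^ m = 1) (f : E[X]) :
    aeval x (cyclicConj q m f) = aeval x⁻¹ (conjPoly q f) := by
  rw [cyclicConj, aeval_comp, map_pow, aeval_X]
  congr 2
  refine eq_inv_of_mul_eq_one_left ?_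
  rw [← pow_succ, Nat.sub_add_cancel hm, hx]

theorem aeval_inv_pow_cyclicConj
    (hconj : ∀ (f : E[X]) (x : K), aeval (x ^ q) (conjPoly q f) = aeval x f ^ q)
    (hm : 0 < m) {x : K} (hx : x ^ m = 1) (f : E[X]) :
    aeval (x ^ q)⁻¹ (cyclicConj q m f) = aeval x f ^ q := by
  rw [aeval_cyclicConj hm (inv_pow_pow_eq_one hx), inv_inv, hconj]

theorem isLCDWith_qcHermInner_iff [IsAlgClosed K] (σ : E →+* E) (hσ : ∀ a, σ a = a ^ q)
    (φ : K →+* K) (hφ : ∀ x, φ x = x ^ q) (hq : 0 < q) (hm : 0 < m)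
    (hsep : (X ^ m - 1 : E[X]).Separable) (g₁₁ g₁₂ g₂₂ : E[X]) :
    IsLCDWith
      (Submodule.span (AdjoinRoot (X ^ m - 1 : E[X]))
        {(AdjoinRoot.mk (X ^ m - 1 : E[X]) g₁₁, AdjoinRoot.mk (X ^ m - 1 : E[X]) g₁₂),
          (0, AdjoinRoot.mk (X ^ m - 1 : E[X]) g₂₂)})
      (qcHermInner q hm) ↔
    ∀ a b : E[X],
      (∀ x : K, x ^ m = 1 →
        aeval (x ^ q)⁻¹ g₁₁ * aeval x (a * g₁₁) ^ q +
          aeval (x ^ q)⁻¹ g₁₂ * aeval x (a * g₁₂ + b * g₂₂) ^ q = 0 ∧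
        aeval (x ^ q)⁻¹ g₂₂ * aeval x (a * g₁₂ + b * g₂₂) ^ q = 0) →
      ∀ x : K, x ^ m = 1 → aeval x (a * g₁₁) = 0 ∧ aeval x (a * g₁₂ + b * g₂₂) = 0 := by
  have hconj := aeval_pow_conjPoly σ hσ φ hφ
  have hsurj : ∀ y : K, y ^ m = 1 → ∃ x : K, x ^ m = 1 ∧ (x ^ q)⁻¹ = y := by
    intro y hy
    obtain ⟨x, hx⟩ := IsAlgClosed.exists_pow_nat_eq y⁻¹ hq
    refine ⟨x, φ.injective ?_, by rw [hx, inv_inv]⟩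
    rw [hφ, map_one, ← pow_mul, mul_comm, pow_mul, hx, inv_pow, hy, inv_one]
  have hred : ∀ (f : E[X]) (x : K), x ^ m = 1 → aeval x
      (AdjoinRoot.modByMonicHom (monic_X_pow_sub_one (E := E) hm) (AdjoinRoot.mk _ f))
        = aeval x f := by
    intro f x hx
    rw [AdjoinRoot.modByMonicHom_mk,
      aeval_modByMonic_eq_self_of_root ((aeval_X_pow_sub_one_eq_zero_iff x).2 hx)]
  have hzero : ∀ c d f h : E[X],
      AdjoinRoot.mk (X ^ m - 1 : E[X]) c * AdjoinRoot.mk (X ^ m - 1 : E[X]) (cyclicConj q m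
          (AdjoinRoot.modByMonicHom (monic_X_pow_sub_one (E := E) hm) (AdjoinRoot.mk _ f))) +
        AdjoinRoot.mk (X ^ m - 1 : E[X]) d * AdjoinRoot.mk (X ^ m - 1 : E[X]) (cyclicConj q m
          (AdjoinRoot.modByMonicHom (monic_X_pow_sub_one (E := E) hm) (AdjoinRoot.mk _ h))) = 0 ↔
      ∀ x : K, x ^ m = 1 →
        aeval (x ^ q)⁻¹ c * aeval x f ^ q + aeval (x ^ q)⁻¹ d * aeval x h ^ q = 0 := by
    intro c d f h
    rw [← map_mul, ← map_mul, ← map_add, mk_X_pow_sub_one_eq_zero_iff (K := K) hsep]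
    have key : ∀ x : K, x ^ m = 1 → aeval (x ^ q)⁻¹ (c * cyclicConj q m
          (AdjoinRoot.modByMonicHom (monic_X_pow_sub_one (E := E) hm) (AdjoinRoot.mk _ f)) +
        d * cyclicConj q m
          (AdjoinRoot.modByMonicHom (monic_X_pow_sub_one (E := E) hm) (AdjoinRoot.mk _ h)))
        = aeval (x ^ q)⁻¹ c * aeval x f ^ q + aeval (x ^ q)⁻¹ d * aeval x h ^ q := by
      intro x hx
      rw [map_add, map_mul, map_mul, aeval_inv_pow_cyclicConj hconj hm hx,
        aeval_inv_pow_cyclicConj hconj hm hx, hred f x hx, hred h x hx]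
    constructor
    · intro H x hx
      rw [← key x hx, H _ (inv_pow_pow_eq_one hx)]
    · intro H y hy
      obtain ⟨x, hx, rfl⟩ := hsurj y hy
      rw [key x hx, H x hx]
  have hdual : ∀ f h : E[X],
      (∀ u ∈ Submodule.span (AdjoinRoot (X ^ m - 1 : E[X]))
        {(AdjoinRoot.mk (X ^ m - 1 : E[X]) g₁₁, AdjoinRoot.mk (X ^ m - 1 : E[X]) g₁₂),
          (0, AdjoinRoot.mk (X ^ m - 1 : E[X]) g₂₂)},
        qcHermInner q hm u (AdjoinRoot.mk _ f, AdjoinRoot.mk _ h) = 0) ↔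
      ∀ x : K, x ^ m = 1 →
        aeval (x ^ q)⁻¹ g₁₁ * aeval x f ^ q + aeval (x ^ q)⁻¹ g₁₂ * aeval x h ^ q = 0 ∧
        aeval (x ^ q)⁻¹ g₂₂ * aeval x h ^ q = 0 := by
    intro f h
    have h0 := hzero 0 g₂₂ f h
    simp only [map_zero, zero_mul, zero_add] at h0
    rw [forall_mem_span_pair_qcHermInner_eq_zero_iff σ hσ hm]
    simp only [Set.mem_insert_iff, Set.mem_singleton_iff, forall_eq_or_imp, forall_eq, zero_mul,
      zero_add]
    rw [hzero, h0]
    exact ⟨fun H x hx => ⟨H.1 x hx, H.2 x hx⟩, fun H => ⟨fun x hx => (H x hx).1,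
      fun x hx => (H x hx).2⟩⟩
  have hmem : ∀ a b : E[X],
      AdjoinRoot.mk (X ^ m - 1 : E[X]) a • (AdjoinRoot.mk (X ^ m - 1 : E[X]) g₁₁,
          AdjoinRoot.mk (X ^ m - 1 : E[X]) g₁₂) +
        AdjoinRoot.mk (X ^ m - 1 : E[X]) b • ((0 : AdjoinRoot (X ^ m - 1 : E[X])),
          AdjoinRoot.mk (X ^ m - 1 : E[X]) g₂₂) =
      (AdjoinRoot.mk _ (a * g₁₁), AdjoinRoot.mk _ (a * g₁₂ + b * g₂₂)) := by
    intro a b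
    simp
  constructor
  · intro H a b hab
    have hv := H _ (Submodule.mem_span_pair.2 ⟨_, _, hmem a b⟩) ((hdual _ _).2 hab)
    rw [Prod.mk_eq_zero, mk_X_pow_sub_one_eq_zero_iff (K := K) hsep,
      mk_X_pow_sub_one_eq_zero_iff (K := K) hsep] at hv
    exact fun x hx => ⟨hv.1 x hx, hv.2 x hx⟩
  · intro H v hv hdv
    obtain ⟨a, b, rfl⟩ := Submodule.mem_span_pair.1 hv
    obtain ⟨a, rfl⟩ := AdjoinRoot.mk_surjective a
    obtain ⟨b, rfl⟩ := AdjoinRoot.mk_surjective b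
    rw [hmem] at hdv ⊢
    have hab := H a b ((hdual _ _).1 hdv)
    rw [Prod.mk_eq_zero, mk_X_pow_sub_one_eq_zero_iff (K := K) hsep,
      mk_X_pow_sub_one_eq_zero_iff (K := K) hsep]
    exact ⟨fun x hx => (hab x hx).1, fun x hx => (hab x hx).2⟩

end Duality

section Pointwise

variable {E K : Type} [Field E] [Field K] [Algebra E K] {q m : ℕ}

theorem aeval_inv_conjPoly_pow
    (hconj : ∀ (f : E[X]) (x : K), aeval (x ^ q) (conjPoly q f) = aeval x f ^ q)
    (hinv : ∀ f : E[X], conjPoly q (conjPoly q f) = f) (f : E[X]) (x : K) :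
    aeval x⁻¹ (conjPoly q f) ^ q = aeval (x ^ q)⁻¹ f := by
  rw [← hconj, hinv, inv_pow]

theorem aeval_cyclicConj_eq_zero_iff
    (hconj : ∀ (f : E[X]) (x : K), aeval (x ^ q) (conjPoly q f) = aeval x f ^ q)
    (hinv : ∀ f : E[X], conjPoly q (conjPoly q f) = f) (hq : 0 < q) (hm : 0 < m)
    {x : K} (hx : x ^ m = 1) (f : E[X]) :
    aeval x (cyclicConj q m f) = 0 ↔ aeval (x ^ q)⁻¹ f = 0 := by
  rw [← aeval_inv_conjPoly_pow hconj hinv, aeval_cyclicConj hm hx, pow_eq_zero_iff hq.ne']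

theorem aeval_inv_pow_inv_pow_eq_zero_iff
    (hconj : ∀ (f : E[X]) (x : K), aeval (x ^ q) (conjPoly q f) = aeval x f ^ q)
    (hinv : ∀ f : E[X], conjPoly q (conjPoly q f) = f) (hq : 0 < q) (f : E[X]) (x : K) :
    aeval ((x ^ q)⁻¹ ^ q)⁻¹ f = 0 ↔ aeval x f = 0 := by
  rw [inv_pow, inv_inv, ← hinv f, hconj, hconj, pow_eq_zero_iff hq.ne', pow_eq_zero_iff hq.ne',
    hinv]

theorem aeval_reflect_conjPoly (σ : E →+* E) (hσ : ∀ a, σ a = a ^ q) (hm : 0 < m) {x : K}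
    (hx : x ^ m = 1) {f : E[X]} (hf : f.natDegree ≤ m) :
    aeval x ((conjPoly q f).reflect m) = aeval x (cyclicConj q m f) := by
  rw [aeval_reflect ((natDegree_conjPoly σ hσ f).trans_le hf) (ne_zero_of_pow_eq_one hm hx), hx,
    one_mul, aeval_cyclicConj hm hx]

theorem aeval_conjReciprocal_eq_zero_iff (σ : E →+* E) (hσ : ∀ a, σ a = a ^ q)
    (hconj : ∀ (f : E[X]) (x : K), aeval (x ^ q) (conjPoly q f) = aeval x f ^ q)
    (hinv : ∀ f : E[X], conjPoly q (conjPoly q f) = f) (hq : 0 < q) (f : E[X]) {x : K}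
    (hx : x ≠ 0) : aeval x (conjReciprocal q f) = 0 ↔ aeval (x ^ q)⁻¹ f = 0 := by
  rw [conjReciprocal, aeval_reflect (natDegree_conjPoly σ hσ f).le hx, mul_eq_zero,
    or_iff_right (pow_ne_zero _ hx), ← aeval_inv_conjPoly_pow hconj hinv, pow_eq_zero_iff hq.ne']

theorem isSelfConjReciprocal_iff [IsAlgClosed K] (σ : E →+* E) (hσ : ∀ a, σ a = a ^ q)
    (hconj : ∀ (f : E[X]) (x : K), aeval (x ^ q) (conjPoly q f) = aeval x f ^ q)
    (hinv : ∀ f : E[X], conjPoly q (conjPoly q f) = f) (hq : 0 < q) (hm : 0 < m)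
    (hsep : (X ^ m - 1 : E[X]).Separable) {f : E[X]} (hf : f ∣ X ^ m - 1) :
    IsSelfConjReciprocal q f ↔
      ∀ x : K, x ^ m = 1 → aeval x f = 0 → aeval (x ^ q)⁻¹ f = 0 := by
  constructor
  · rintro ⟨α, -, hα⟩ x hx hfx
    rw [← aeval_conjReciprocal_eq_zero_iff σ hσ hconj hinv hq f (ne_zero_of_pow_eq_one hm hx), hα,
      map_mul, hfx, mul_zero]
  · intro H
    have hf0 : f ≠ 0 := ne_zero_of_dvd_ne_zero hsep.ne_zero hf
    have hroot : ∀ x : K, aeval x f = 0 → x ^ m = 1 := by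
      intro x hx
      obtain ⟨c, hc⟩ := hf
      rw [← aeval_X_pow_sub_one_eq_zero_iff (E := E), hc, map_mul, hx, zero_mul]
    have hdvd : f ∣ conjReciprocal q f :=
      (hsep.of_dvd hf).dvd_of_forall_aeval_eq_zero fun x hx =>
        (aeval_conjReciprocal_eq_zero_iff σ hσ hconj hinv hq f
          (ne_zero_of_pow_eq_one hm (hroot x hx))).2 (H x (hroot x hx) hx)
    have hne : conjReciprocal q f ≠ 0 := by
      rw [conjReciprocal, Ne, reflect_eq_zero_iff, conjPoly_eq_map σ hσ,
        Polynomial.map_eq_zero]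
      exact hf0
    have hdeg : (conjReciprocal q f).natDegree ≤ f.natDegree :=
      natDegree_reflect_le.trans (max_le le_rfl (natDegree_conjPoly σ hσ f).le)
    obtain ⟨c, hc⟩ := hdvd
    have hc0 : c ≠ 0 := by
      rintro rfl
      exact hne (by rw [hc, mul_zero])
    rw [hc, natDegree_mul hf0 hc0] at hdeg
    have hcC := eq_C_of_natDegree_eq_zero (show c.natDegree = 0 by omega)
    refine ⟨c.coeff 0, fun h0 => hc0 (by rw [hcC, h0, C_0]), ?_⟩
    rw [hc, ← hcC, mul_comm]

theorem forall_aeval_eq_zero_of_orthogonal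
    (hconj : ∀ (f : E[X]) (x : K), aeval (x ^ q) (conjPoly q f) = aeval x f ^ q)
    (hinv : ∀ f : E[X], conjPoly q (conjPoly q f) = f) (hq : 0 < q) (hm : 0 < m)
    {g₁₁ g₁₂ g₂₂ : E[X]}
    (h₁₂ : ∀ x : K, aeval x g₁₁ = 0 → aeval x g₂₂ = 0 → aeval x g₁₂ = 0)
    (hI : ∀ x : K, x ^ m = 1 → aeval x g₁₁ = 0 → aeval x g₂₂ = 0 →
      aeval (x ^ q)⁻¹ g₁₁ = 0 ∧ aeval (x ^ q)⁻¹ g₂₂ = 0)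
    (hII : ∀ x : K, x ^ m = 1 → aeval x g₁₁ ≠ 0 → aeval x g₂₂ ≠ 0 →
      aeval (x ^ q)⁻¹ g₁₁ ≠ 0 ∧ aeval (x ^ q)⁻¹ g₂₂ ≠ 0)
    (hIII : ∀ x : K, x ^ m = 1 → aeval x g₂₂ = 0 → aeval x g₁₁ ≠ 0 →
      ¬ (aeval (x ^ q)⁻¹ g₂₂ = 0 ∧ aeval (x ^ q)⁻¹ g₁₁ ≠ 0) → aeval x g₁₂ ≠ 0)
    (hIV : ∀ x : K, x ^ m = 1 → aeval x g₂₂ = 0 → aeval x g₁₁ ≠ 0 →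
      aeval (x ^ q)⁻¹ g₂₂ = 0 → aeval (x ^ q)⁻¹ g₁₁ ≠ 0 →
      aeval x (g₁₁ * cyclicConj q m g₁₁ + g₁₂ * cyclicConj q m g₁₂) ≠ 0)
    (a b : E[X]) {x : K} (hx : x ^ m = 1)
    (h1 : aeval (x ^ q)⁻¹ g₁₁ * aeval x (a * g₁₁) ^ q +
      aeval (x ^ q)⁻¹ g₁₂ * aeval x (a * g₁₂ + b * g₂₂) ^ q = 0)
    (h2 : aeval (x ^ q)⁻¹ g₂₂ * aeval x (a * g₁₂ + b * g₂₂) ^ q = 0) :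
    aeval x (a * g₁₁) = 0 ∧ aeval x (a * g₁₂ + b * g₂₂) = 0 := by
  have hrr := aeval_inv_pow_inv_pow_eq_zero_iff (K := K) hconj hinv hq
  have hρ : (x ^ q)⁻¹ ^ m = 1 := inv_pow_pow_eq_one hx
  have hI' := hI _ hρ
  have hII' := hII _ hρ
  have hIII' := hIII _ hρ
  have hIV' := hIV _ hρ
  rw [map_add, map_mul, map_mul, aeval_inv_pow_cyclicConj hconj hm hx,
    aeval_inv_pow_cyclicConj hconj hm hx] at hIV'
  simp only [Ne, hrr] at hI' hII' hIII' hIV'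
  specialize h₁₂ x
  specialize hI x hx
  specialize hII x hx
  specialize hIII x hx
  by_cases z11 : aeval (x ^ q)⁻¹ g₁₁ = 0 <;> by_cases z22 : aeval (x ^ q)⁻¹ g₂₂ = 0
  · obtain ⟨y11, y22⟩ := hI' z11 z22
    simp [y11, y22, h₁₂ y11 y22]
  · have hV : aeval x (a * g₁₂ + b * g₂₂) = 0 := by simpa [z22, hq.ne'] using h2
    refine ⟨?_, hV⟩
    by_cases y11 : aeval x g₁₁ = 0
    · simp [y11]
    by_cases y22 : aeval x g₂₂ = 0
    · have y12 := hIII y22 y11 fun h => z22 h.1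
      simp only [map_add, map_mul, y22, mul_zero, add_zero, mul_eq_zero, y12, or_false] at hV
      simp [hV]
    · exact absurd z11 (hII y11 y22).1
  · by_cases y11 : aeval x g₁₁ = 0
    · have y22 : aeval x g₂₂ ≠ 0 := fun y22 => z11 (hI y11 y22).1
      have z12 := hIII' z22 z11 fun h => h.2 y11
      simp only [map_mul, y11, mul_zero, zero_pow hq.ne', zero_add, mul_eq_zero, z12, false_or,
        pow_eq_zero_iff hq.ne'] at h1
      exact ⟨by simp [y11], h1⟩
    · by_cases y22 : aeval x g₂₂ = 0
      · have hS := hIV' z22 z11 y22 y11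
        simp only [map_add, map_mul, y22, mul_zero, add_zero] at h1
        have h3 : aeval x a ^ q * (aeval (x ^ q)⁻¹ g₁₁ * aeval x g₁₁ ^ q +
            aeval (x ^ q)⁻¹ g₁₂ * aeval x g₁₂ ^ q) = 0 := by
          rw [← h1, mul_pow, mul_pow]
          ring
        have ha := (pow_eq_zero_iff hq.ne').1 ((mul_eq_zero.1 h3).resolve_right hS)
        simp [ha, y22]
      · exact absurd z22 (hII y11 y22).2
  · have hV : aeval x (a * g₁₂ + b * g₂₂) = 0 := by simpa [z22, hq.ne'] using h2
    refine ⟨?_, hV⟩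
    simpa [hV, hq.ne', z11] using h1

theorem pointwise_conditions_of_isLCD [IsAlgClosed K]
    (hconj : ∀ (f : E[X]) (x : K), aeval (x ^ q) (conjPoly q f) = aeval x f ^ q)
    (hinv : ∀ f : E[X], conjPoly q (conjPoly q f) = f)
    (hneg : ∀ x : K, (-x) ^ q = -x ^ q) (hq : 0 < q) (hm : 0 < m)
    (hsep : (X ^ m - 1 : E[X]).Separable) {g₁₁ g₁₂ g₂₂ : E[X]}
    (h₁₁ : g₁₁ ∣ X ^ m - 1) (h₂₂ : g₂₂ ∣ X ^ m - 1)
    (h₁₂ : ∀ x : K, aeval x g₁₁ = 0 → aeval x g₂₂ = 0 → aeval x g₁₂ = 0)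
    (H : ∀ a b : E[X],
      (∀ x : K, x ^ m = 1 →
        aeval (x ^ q)⁻¹ g₁₁ * aeval x (a * g₁₁) ^ q +
          aeval (x ^ q)⁻¹ g₁₂ * aeval x (a * g₁₂ + b * g₂₂) ^ q = 0 ∧
        aeval (x ^ q)⁻¹ g₂₂ * aeval x (a * g₁₂ + b * g₂₂) ^ q = 0) →
      ∀ x : K, x ^ m = 1 → aeval x (a * g₁₁) = 0 ∧ aeval x (a * g₁₂ + b * g₂₂) = 0) :
    (∀ x : K, x ^ m = 1 → aeval x g₁₁ = 0 → aeval x g₂₂ = 0 →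
      aeval (x ^ q)⁻¹ g₁₁ = 0 ∧ aeval (x ^ q)⁻¹ g₂₂ = 0) ∧
    (∀ x : K, x ^ m = 1 → aeval x g₁₁ ≠ 0 → aeval x g₂₂ ≠ 0 →
      aeval (x ^ q)⁻¹ g₁₁ ≠ 0 ∧ aeval (x ^ q)⁻¹ g₂₂ ≠ 0) ∧
    (∀ x : K, x ^ m = 1 → aeval x g₂₂ = 0 → aeval x g₁₁ ≠ 0 →
      ¬ (aeval (x ^ q)⁻¹ g₂₂ = 0 ∧ aeval (x ^ q)⁻¹ g₁₁ ≠ 0) → aeval x g₁₂ ≠ 0) ∧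
    (∀ x : K, x ^ m = 1 → aeval x g₂₂ = 0 → aeval x g₁₁ ≠ 0 →
      aeval (x ^ q)⁻¹ g₂₂ = 0 → aeval (x ^ q)⁻¹ g₁₁ ≠ 0 →
      aeval x (g₁₁ * cyclicConj q m g₁₁ + g₁₂ * cyclicConj q m g₁₂) ≠ 0) := by
  classical
  have hrr := aeval_inv_pow_inv_pow_eq_zero_iff (K := K) hconj hinv hq
  have hcomp : ∀ d : E[X], d ∣ X ^ m - 1 → ∀ x : K, x ^ m = 1 →
      (aeval x ((X ^ m - 1) / d) = 0 ↔ aeval x d ≠ 0) := by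
    intro d hd x hx
    rw [hsep.aeval_div_eq_zero_iff hd, aeval_X_pow_sub_one_eq_zero_iff]
    tauto
  have hbar : ∀ d : E[X], d ∣ X ^ m - 1 → ∀ x : K, x ^ m = 1 →
      (aeval x (cyclicConj q m ((X ^ m - 1) / d)) = 0 ↔ aeval (x ^ q)⁻¹ d ≠ 0) := by
    intro d hd x hx
    rw [aeval_cyclicConj_eq_zero_iff hconj hinv hq hm hx, hcomp d hd _ (inv_pow_pow_eq_one hx)]
  have hI : ∀ x : K, x ^ m = 1 → aeval (x ^ q)⁻¹ g₁₁ = 0 → aeval (x ^ q)⁻¹ g₂₂ = 0 →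
      aeval x g₁₁ = 0 ∧ aeval x g₂₂ = 0 := by
    intro x hx z11 z22
    have hg := hbar _ ((gcd_dvd_left g₁₁ g₂₂).trans h₁₁)
    set e := cyclicConj q m ((X ^ m - 1) / gcd g₁₁ g₂₂)
    simp only [Ne, aeval_gcd_eq_zero_iff] at hg
    have he : aeval x e ≠ 0 := fun h => (hg x hx).1 h ⟨z11, z22⟩
    have hall : ∀ y : K, y ^ m = 1 → aeval y e = 0 ∨
        (aeval (y ^ q)⁻¹ g₁₁ = 0 ∧ aeval (y ^ q)⁻¹ g₂₂ = 0 ∧ aeval (y ^ q)⁻¹ g₁₂ = 0) := by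
      intro y hy
      by_cases h : aeval y e = 0
      · exact Or.inl h
      · have h' : aeval (y ^ q)⁻¹ g₁₁ = 0 ∧ aeval (y ^ q)⁻¹ g₂₂ = 0 := by
          by_contra h''
          exact h ((hg y hy).2 h'')
        exact Or.inr ⟨h'.1, h'.2, h₁₂ _ h'.1 h'.2⟩
    have e1 := H e 0 (fun y hy => by
      rcases hall y hy with h | ⟨h1, h2, h3⟩
      · simp [h, hq.ne']
      · simp [h1, h2, h3]) x hx
    have e2 := H 0 e (fun y hy => by
      rcases hall y hy with h | ⟨h1, h2, h3⟩
      · simp [h, hq.ne']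
      · simp [h1, h2, h3]) x hx
    simp only [map_add, map_mul, map_zero, zero_mul, zero_add, mul_eq_zero, he, false_or] at e1 e2
    exact ⟨e1.1, e2.2⟩
  have hII : ∀ x : K, x ^ m = 1 → aeval x g₁₁ ≠ 0 → aeval x g₂₂ ≠ 0 →
      aeval (x ^ q)⁻¹ g₁₁ ≠ 0 ∧ aeval (x ^ q)⁻¹ g₂₂ ≠ 0 := by
    intro x hx y11 y22
    obtain ⟨k, hk⟩ := dvd_lcm_left g₁₁ g₂₂
    obtain ⟨i, hi⟩ := dvd_lcm_right g₁₁ g₂₂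
    have hL := aeval_lcm_eq_zero_iff (K := K) g₁₁ g₂₂
    set L := lcm g₁₁ g₂₂
    have hLx : aeval x L ≠ 0 := by
      rw [Ne, hL]
      exact not_or.2 ⟨y11, y22⟩
    obtain ⟨j, hj⟩ : g₂₂ ∣ k * g₁₂ :=
      (hsep.of_dvd h₂₂).dvd_of_forall_aeval_eq_zero (K := K) fun y hy => by
        by_cases y11 : aeval y g₁₁ = 0
        · rw [map_mul, h₁₂ y y11 hy, mul_zero]
        · have hLy := (hL y).2 (Or.inr hy)
          rw [hk, map_mul] at hLy
          rw [map_mul, (mul_eq_zero.1 hLy).resolve_left y11, zero_mul]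
    have hC : ∀ f h : E[X],
        (∀ y : K, y ^ m = 1 →
          aeval (y ^ q)⁻¹ g₁₁ * aeval y (L * f) ^ q +
            aeval (y ^ q)⁻¹ g₁₂ * aeval y (L * h) ^ q = 0 ∧
          aeval (y ^ q)⁻¹ g₂₂ * aeval y (L * h) ^ q = 0) →
        aeval x f = 0 ∧ aeval x h = 0 := by
      intro f h hfh
      have e1 : k * f * g₁₁ = L * f := by rw [hk]; ring
      have e2 : k * f * g₁₂ + (i * h - j * f) * g₂₂ = L * h := by
        rw [hi]
        linear_combination f * hj
      have h3 := H (k * f) (i * h - j * f) (by rwa [e1, e2]) x hx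
      rw [e1, e2] at h3
      simpa [hLx] using h3
    have z11 : aeval (x ^ q)⁻¹ g₁₁ ≠ 0 := by
      rw [← hbar g₁₁ h₁₁ x hx]
      refine (hC _ 0 fun y hy => ?_).1
      by_cases hy0 : aeval (y ^ q)⁻¹ g₁₁ = 0
      · simp [hy0, hq.ne']
      · rw [map_mul, (hbar g₁₁ h₁₁ y hy).2 hy0]
        simp [hq.ne']
    refine ⟨z11, ?_⟩
    have h3 := hC (-(cyclicConj q m ((X ^ m - 1) / g₂₂) * cyclicConj q m g₁₂))
      (cyclicConj q m ((X ^ m - 1) / g₂₂) * cyclicConj q m g₁₁) fun y hy => by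
        have hyρ := inv_pow_pow_eq_one (q := q) hy
        have hp : ∀ f : E[X], aeval y (cyclicConj q m f) ^ q = aeval (y ^ q)⁻¹ f := by
          intro f
          rw [aeval_cyclicConj hm hy, aeval_inv_conjPoly_pow hconj hinv]
        have h0 : aeval (y ^ q)⁻¹ g₂₂ * aeval (y ^ q)⁻¹ ((X ^ m - 1) / g₂₂) = 0 := by
          by_cases hy0 : aeval (y ^ q)⁻¹ g₂₂ = 0
          · rw [hy0, zero_mul]
          · rw [(hcomp g₂₂ h₂₂ _ hyρ).2 hy0, mul_zero]
        simp only [map_mul, map_neg, mul_pow, hneg, hp]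
        constructor
        · ring
        · linear_combination (aeval y L ^ q * aeval (y ^ q)⁻¹ g₁₁) * h0
    have h4 := h3.2
    rw [map_mul, mul_eq_zero, hbar g₂₂ h₂₂ x hx,
      aeval_cyclicConj_eq_zero_iff hconj hinv hq hm hx] at h4
    exact h4.resolve_right z11
  refine ⟨fun x hx y11 y22 => hI _ (inv_pow_pow_eq_one hx) ((hrr _ _).2 y11) ((hrr _ _).2 y22),
    hII, ?_, ?_⟩
  · intro x hx y22 y11 hnot y12
    have z11 : aeval (x ^ q)⁻¹ g₁₁ = 0 := by
      by_contra z11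
      have z22 : aeval (x ^ q)⁻¹ g₂₂ ≠ 0 := fun z22 => hnot ⟨z22, z11⟩
      have h3 := (hII _ (inv_pow_pow_eq_one hx) z11 z22).2
      rw [Ne, hrr] at h3
      exact h3 y22
    have hn := hcomp _ ((gcd_dvd_left g₂₂ g₁₂).trans h₂₂)
    have he := hbar _ h₁₁
    set n := (X ^ m - 1) / gcd g₂₂ g₁₂
    set e := cyclicConj q m ((X ^ m - 1) / g₁₁)
    simp only [Ne, aeval_gcd_eq_zero_iff] at hn
    have h3 := H (e * n) 0 (fun y hy => by
      by_cases hy0 : aeval (y ^ q)⁻¹ g₁₁ = 0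
      · by_cases hy1 : aeval y g₁₂ = 0
        · simp [hy0, hy1, hq.ne']
        · simp [(hn y hy).2 fun h => hy1 h.2, hq.ne']
      · simp [(he y hy).2 hy0, hq.ne']) x hx
    have h4 : aeval x e ≠ 0 := fun h => (he x hx).1 h z11
    have h5 : aeval x n ≠ 0 := fun h => (hn x hx).1 h ⟨y22, y12⟩
    simp [h4, h5, y11] at h3
  · intro x hx y22 y11 z22 z11 hS
    set S := g₁₁ * cyclicConj q m g₁₁ + g₁₂ * cyclicConj q m g₁₂
    have he := hbar _ ((gcd_dvd_left g₂₂ S).trans h₂₂)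
    set e := cyclicConj q m ((X ^ m - 1) / gcd g₂₂ S)
    simp only [Ne, aeval_gcd_eq_zero_iff] at he
    have h3 := H e 0 (fun y hy => by
      by_cases hy0 : aeval y e = 0
      · simp [hy0, hq.ne']
      · obtain ⟨h4, h5⟩ : aeval (y ^ q)⁻¹ g₂₂ = 0 ∧ aeval (y ^ q)⁻¹ S = 0 := by
          by_contra h
          exact hy0 ((he y hy).2 h)
        rw [map_add, map_mul, map_mul, aeval_inv_pow_cyclicConj hconj hm hy,
          aeval_inv_pow_cyclicConj hconj hm hy] at h5
        simp only [h4, zero_mul, add_zero, map_mul, mul_pow, and_true]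
        linear_combination aeval y e ^ q * h5) _ (inv_pow_pow_eq_one (q := q) hx)
    have h4 : aeval (x ^ q)⁻¹ e ≠ 0 := fun h =>
      (he _ (inv_pow_pow_eq_one hx)).1 h ⟨(hrr _ _).2 y22, (hrr _ _).2 hS⟩
    simp [h4, z11] at h3

end Pointwise

/-- Characterization of Hermitian LCD quasi-cyclic codes of index 2 over the field `E`
with `q²` elements: `C = ⟨(g11, g12), (0, g22)⟩` is Hermitian LCD iff
(I) `g` is self-conjugate-reciprocal, (II) `l` is self-conjugate-reciprocal,
(III) `gcd(t22, g12) = 1`, and (IV) `gcd(r22, g11·ĝ11 + g12·ĝ12) = 1`. -/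
theorem stmt17 (E : Type) [Field E] [Fintype E] [DecidableEq E] (q : ℕ) (hq : IsPrimePow q)
    (hcard : Fintype.card E = q ^ 2) (m : ℕ) (hm : 0 < m)
    (hqm : Nat.Coprime q m)
    (g11 g12 g22 : E[X])
    (h1 : g11 ∣ X ^ m - 1) (h2 : g22 ∣ X ^ m - 1)
    (h3 : g12.degree < g22.degree) (h4 : g11 * g22 ∣ (X ^ m - 1) * g12)
    (g l g11' g22' r11 t11 r22 t22 : E[X])
    (hg : g = gcd g11 g22) (hl : l = (X ^ m - 1) / lcm g11 g22)
    (h11' : g11' = g11 / g) (h22' : g22' = g22 / g)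
    (hr11 : r11 = gcd g11' (conjReciprocal q g11')) (ht11 : t11 = g11' / r11)
    (hr22 : r22 = gcd g22' (conjReciprocal q g22')) (ht22 : t22 = g22' / r22)
    :
    IsLCDWith
      (Submodule.span (AdjoinRoot (X ^ m - 1 : E[X]))
        {(AdjoinRoot.mk (X ^ m - 1 : E[X]) g11, AdjoinRoot.mk (X ^ m - 1 : E[X]) g12), (0, AdjoinRoot.mk (X ^ m - 1 : E[X]) g22)})
      (qcHermInner q hm) ↔
    (IsSelfConjReciprocal q g ∧ IsSelfConjReciprocal q l ∧ IsCoprime t22 g12 ∧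
      IsCoprime r22
        (g11 * (conjPoly q g11).reflect m + g12 * (conjPoly q g12).reflect m)) := by
  classical
  obtain ⟨p, k, hp, -, hpk⟩ := hq
  have hp' : p.Prime := hp.nat_prime
  have : Fact p.Prime := ⟨hp'⟩
  have hcard' : Fintype.card E = p ^ (k * 2) := by rw [hcard, ← hpk, pow_mul]
  have hchar : CharP E p := charP_of_card_eq_prime_pow hcard'
  let K := AlgebraicClosure E
  have hcharK : CharP K p := charP_of_injective_algebraMap (algebraMap E K).injective p
  have hσ : ∀ a : E, iterateFrobenius E p k a = a ^ q := fun a => by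
    rw [iterateFrobenius_def, hpk]
  have hφ : ∀ a : K, iterateFrobenius K p k a = a ^ q := fun a => by
    rw [iterateFrobenius_def, hpk]
  have hq0 : 0 < q := hpk ▸ pow_pos hp'.pos k
  have hneg : ∀ x : K, (-x) ^ q = -x ^ q := fun x => by rw [← hφ, ← hφ, map_neg]
  have hinv := conjPoly_conjPoly (iterateFrobenius E p k) hσ
    (fun a => by rw [← hcard, FiniteField.pow_card])
  have hconj := aeval_pow_conjPoly (K := K) (iterateFrobenius E p k) hσ (iterateFrobenius K p k) hφ
  have hsep : (X ^ m - 1 : E[X]).Separable := by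
    rw [X_pow_sub_one_separable_iff, Ne, CharP.cast_eq_zero_iff E p]
    intro hpm
    have hk : k ≠ 0 := by
      rintro rfl
      have h1 : Fintype.card E = 1 := by simpa using hcard'
      exact (Fintype.one_lt_card (α := E)).ne' h1
    have hdvd : p ∣ Nat.gcd q m := Nat.dvd_gcd (hpk ▸ dvd_pow_self p hk) hpm
    rw [hqm] at hdvd
    exact hp'.one_lt.ne' (Nat.dvd_one.1 hdvd)
  have h12 : ∀ x : K, aeval x g11 = 0 → aeval x g22 = 0 → aeval x g12 = 0 := by
    intro x y11 y22
    have hg0 : g11 ≠ 0 := ne_zero_of_dvd_ne_zero hsep.ne_zero h1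
    have hc := EuclideanDomain.mul_div_cancel' hg0 h1
    have hcx : aeval x ((X ^ m - 1) / g11) ≠ 0 := fun h =>
      ((hsep.aeval_div_eq_zero_iff h1 x).1 h).2 y11
    rw [← hc, mul_assoc] at h4
    obtain ⟨d, hd⟩ := (mul_dvd_mul_iff_left hg0).1 h4
    have hx := congrArg (aeval x) hd
    rw [map_mul, map_mul, y22, zero_mul] at hx
    exact (mul_eq_zero.1 hx).resolve_left hcx
  have hroot : ∀ f : E[X], f ∣ X ^ m - 1 → ∀ x : K, aeval x f = 0 → x ^ m = 1 := by
    rintro f ⟨c, hc⟩ x hx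
    rw [← aeval_X_pow_sub_one_eq_zero_iff (E := E), hc, map_mul, hx, zero_mul]
  have hgdvd : g ∣ g22 := hg ▸ gcd_dvd_right g11 g22
  have hgx : ∀ x : K, aeval x g = 0 ↔ aeval x g11 = 0 ∧ aeval x g22 = 0 := fun x => by
    rw [hg, aeval_gcd_eq_zero_iff]
  have hlcm : lcm g11 g22 ∣ X ^ m - 1 := lcm_dvd h1 h2
  have hldvd : l ∣ X ^ m - 1 := hl ▸ EuclideanDomain.div_dvd_of_dvd hlcm
  have hlx : ∀ x : K, x ^ m = 1 → (aeval x l = 0 ↔ aeval x g11 ≠ 0 ∧ aeval x g22 ≠ 0) := by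
    intro x hx
    rw [hl, hsep.aeval_div_eq_zero_iff hlcm, aeval_X_pow_sub_one_eq_zero_iff, Ne,
      aeval_lcm_eq_zero_iff, not_or, and_iff_right hx]
  have h22dvd : g22' ∣ X ^ m - 1 := (h22' ▸ EuclideanDomain.div_dvd_of_dvd hgdvd).trans h2
  have h22x : ∀ x : K, aeval x g22' = 0 ↔ aeval x g22 = 0 ∧ aeval x g11 ≠ 0 := fun x => by
    rw [h22', (hsep.of_dvd h2).aeval_div_eq_zero_iff hgdvd, Ne, hgx]
    exact and_congr_right fun y22 => not_congr (and_iff_left y22)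
  have hrdvd : r22 ∣ g22' := hr22 ▸ gcd_dvd_left g22' (conjReciprocal q g22')
  have hr22x : ∀ x : K, aeval x r22 = 0 ↔ aeval x g22' = 0 ∧ aeval (x ^ q)⁻¹ g22' = 0 := by
    intro x
    rw [hr22, aeval_gcd_eq_zero_iff]
    refine and_congr_right fun hx => ?_
    exact aeval_conjReciprocal_eq_zero_iff _ hσ hconj hinv hq0 g22'
      (ne_zero_of_pow_eq_one hm (hroot _ h22dvd x hx))
  have ht22x : ∀ x : K, aeval x t22 = 0 ↔ aeval x g22' = 0 ∧ aeval (x ^ q)⁻¹ g22' ≠ 0 := by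
    intro x
    rw [ht22, (hsep.of_dvd h22dvd).aeval_div_eq_zero_iff hrdvd, Ne, hr22x]
    exact and_congr_right fun y22 => not_congr (and_iff_right y22)
  have hd11 : g11.natDegree ≤ m :=
    (natDegree_le_of_dvd h1 hsep.ne_zero).trans_eq natDegree_X_pow_sub_one
  have hd22 : g22.natDegree ≤ m :=
    (natDegree_le_of_dvd h2 hsep.ne_zero).trans_eq natDegree_X_pow_sub_one
  have hd12 : g12.natDegree ≤ m := (natDegree_le_natDegree h3.le).trans hd22
  have hSx : ∀ x : K, x ^ m = 1 →
      aeval x (g11 * (conjPoly q g11).reflect m + g12 * (conjPoly q g12).reflect m) =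
        aeval x (g11 * cyclicConj q m g11 + g12 * cyclicConj q m g12) := by
    intro x hx
    simp only [map_add, map_mul, aeval_reflect_conjPoly _ hσ hm hx hd11,
      aeval_reflect_conjPoly _ hσ hm hx hd12]
  have hI : IsSelfConjReciprocal q g ↔
      ∀ x : K, x ^ m = 1 → aeval x g11 = 0 → aeval x g22 = 0 →
        aeval (x ^ q)⁻¹ g11 = 0 ∧ aeval (x ^ q)⁻¹ g22 = 0 := by
    rw [isSelfConjReciprocal_iff (K := K) _ hσ hconj hinv hq0 hm hsep (hgdvd.trans h2)]
    simp only [hgx, and_imp]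
  have hII : IsSelfConjReciprocal q l ↔
      ∀ x : K, x ^ m = 1 → aeval x g11 ≠ 0 → aeval x g22 ≠ 0 →
        aeval (x ^ q)⁻¹ g11 ≠ 0 ∧ aeval (x ^ q)⁻¹ g22 ≠ 0 := by
    rw [isSelfConjReciprocal_iff (K := K) _ hσ hconj hinv hq0 hm hsep hldvd]
    refine forall₂_congr fun x hx => ?_
    rw [hlx x hx, hlx _ (inv_pow_pow_eq_one hx), and_imp]
  have hIII : IsCoprime t22 g12 ↔
      ∀ x : K, x ^ m = 1 → aeval x g22 = 0 → aeval x g11 ≠ 0 →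
        ¬ (aeval (x ^ q)⁻¹ g22 = 0 ∧ aeval (x ^ q)⁻¹ g11 ≠ 0) → aeval x g12 ≠ 0 := by
    rw [isCoprime_iff_aeval_ne_zero_of_isAlgClosed E K]
    simp only [Ne, ht22x, h22x]
    constructor
    · intro H x hx y22 y11 hnot
      exact (H x).resolve_left fun h => h ⟨⟨y22, y11⟩, hnot⟩
    · intro H x
      by_cases h : (aeval x g22 = 0 ∧ ¬ aeval x g11 = 0) ∧
          ¬ (aeval (x ^ q)⁻¹ g22 = 0 ∧ ¬ aeval (x ^ q)⁻¹ g11 = 0)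
      · exact Or.inr (H x (hroot g22 h2 x h.1.1) h.1.1 h.1.2 h.2)
      · exact Or.inl h
  have hIV : IsCoprime r22
        (g11 * (conjPoly q g11).reflect m + g12 * (conjPoly q g12).reflect m) ↔
      ∀ x : K, x ^ m = 1 → aeval x g22 = 0 → aeval x g11 ≠ 0 →
        aeval (x ^ q)⁻¹ g22 = 0 → aeval (x ^ q)⁻¹ g11 ≠ 0 →
        aeval x (g11 * cyclicConj q m g11 + g12 * cyclicConj q m g12) ≠ 0 := by
    rw [isCoprime_iff_aeval_ne_zero_of_isAlgClosed E K]
    simp only [Ne, hr22x, h22x]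
    constructor
    · intro H x hx y22 y11 z22 z11
      rw [← hSx x hx]
      exact (H x).resolve_left fun h => h ⟨⟨y22, y11⟩, z22, z11⟩
    · intro H x
      by_cases h : (aeval x g22 = 0 ∧ ¬ aeval x g11 = 0) ∧
          aeval (x ^ q)⁻¹ g22 = 0 ∧ ¬ aeval (x ^ q)⁻¹ g11 = 0
      · have hx := hroot g22 h2 x h.1.1
        rw [hSx x hx]
        exact Or.inr (H x hx h.1.1 h.1.2 h.2.1 h.2.2)
      · exact Or.inl h
  rw [isLCDWith_qcHermInner_iff (K := K) _ hσ _ hφ hq0 hm hsep, hI, hII, hIII, hIV]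
  constructor
  · exact pointwise_conditions_of_isLCD hconj hinv hneg hq0 hm hsep h1 h2 h12
  · rintro ⟨c1, c2, c3, c4⟩ a b H x hx
    exact forall_aeval_eq_zero_of_orthogonal hconj hinv hq0 hm h12 c1 c2 c3 c4 a b hx
      (H x hx).1 (H x hx).2
end
end

section
/- One has x^m − 1 = g·l·r11·t11·r22·t22 up to a nonzero scalar factor in F. Moreover, if g and l are both self-reciprocal, then there exists a nonzero α in F with x^m − 1 = α·g·l·r11·t11*·r22·t22*, and consequently every irreducible factor h(x) of t22(x) satisfies h*(x) divides t11(x). -/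
open Polynomial

noncomputable section

/-- `f` is self-reciprocal: the reciprocal polynomial `f*(x) = x^(deg f)·f(1/x)` is a
nonzero scalar multiple of `f`. -/
def IsSelfReciprocal {F : Type} [Field F] (f : F[X]) : Prop :=
  ∃ α : F, α ≠ 0 ∧ f.reverse = Polynomial.C α * f

section ReverseLemmas

variable {F : Type} [Field F]

theorem reverse_natDegree_of_coeff_zero_ne {f : F[X]} (hf : f.coeff 0 ≠ 0) :
    f.reverse.natDegree = f.natDegree := by
  rw [reverse_natDegree, natTrailingDegree_eq_zero_of_constantCoeff_ne_zero hf, Nat.sub_zero]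

theorem reverse_reverse_of_coeff_zero_ne {f : F[X]} (hf : f.coeff 0 ≠ 0) :
    f.reverse.reverse = f := by
  rw [reverse, reverse_natDegree_of_coeff_zero_ne hf, reverse, reflect_reflect]

theorem reverse_dvd_reverse {f g : F[X]} (h : f ∣ g) : f.reverse ∣ g.reverse := by
  obtain ⟨k, rfl⟩ := h
  exact ⟨k.reverse, reverse_mul_of_domain f k⟩

theorem Associated.reverse {f g : F[X]} (h : Associated f g) :
    Associated f.reverse g.reverse :=
  associated_of_dvd_dvd (reverse_dvd_reverse h.dvd) (reverse_dvd_reverse h.symm.dvd)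

theorem coeff_zero_ne_of_dvd {f g : F[X]} (h : f ∣ g) (hg : g.coeff 0 ≠ 0) :
    f.coeff 0 ≠ 0 := by
  obtain ⟨k, rfl⟩ := h
  exact left_ne_zero_of_mul (mul_coeff_zero f k ▸ hg)

theorem associated_iff_exists_C_mul {f g : F[X]} :
    Associated f g ↔ ∃ c : F, c ≠ 0 ∧ g = C c * f := by
  constructor
  · rintro ⟨u, rfl⟩
    obtain ⟨c, hc, hcu⟩ := Polynomial.isUnit_iff.1 u.isUnit
    exact ⟨c, hc.ne_zero, by rw [hcu, mul_comm]⟩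
  · rintro ⟨c, hc, rfl⟩
    exact (associated_unit_mul_left f _ (isUnit_C.2 hc.isUnit)).symm

theorem associated_reverse_X_pow_sub_one (m : ℕ) :
    Associated (X ^ m - 1 : F[X]).reverse (X ^ m - 1) := by
  refine associated_iff_exists_C_mul.2 ⟨-1, by simp, ?_⟩
  have h : (X ^ m - 1 : F[X]).natDegree = m := natDegree_X_pow_sub_C (r := 1)
  rw [reverse, h, reflect_sub, reflect_monomial, reflect_one, revAt_le le_rfl]
  simp

/-- The greatest common divisor of a polynomial and its reciprocal is self-reciprocal. -/
theorem associated_reverse_gcd_reverse [GCDMonoid F[X]] {f : F[X]} (hf : f.coeff 0 ≠ 0) :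
    Associated (gcd f f.reverse).reverse (gcd f f.reverse) := by
  have hd := coeff_zero_ne_of_dvd (gcd_dvd_left f f.reverse) hf
  refine associated_of_dvd_of_natDegree_le (dvd_gcd ?_ ?_) ?_ ?_
  · simpa only [reverse_reverse_of_coeff_zero_ne hf]
      using reverse_dvd_reverse (gcd_dvd_right f f.reverse)
  · exact reverse_dvd_reverse (gcd_dvd_left f f.reverse)
  · rintro h
    simp [h] at hd
  · rw [reverse_natDegree_of_coeff_zero_ne hd]

/-- For squarefree `f`, the cofactor of `gcd f f*` in `f` is coprime to its own reciprocal. -/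
theorem isCoprime_reverse_of_gcd_mul_eq [GCDMonoid F[X]] {f t : F[X]} (hf : Squarefree f)
    (h : gcd f f.reverse * t = f) : IsCoprime t.reverse t := by
  have ht : t ∣ f := ⟨_, by rw [mul_comm, h]⟩
  refine isCoprime_of_irreducible_dvd ?_ fun p hp h1 h2 => hp.not_isUnit (hf p ?_)
  · rintro ⟨-, rfl⟩
    exact hf.ne_zero (by rw [← h, mul_zero])
  · have hpg : p ∣ gcd f f.reverse :=
      dvd_gcd (h2.trans ht) (h1.trans (reverse_dvd_reverse ht))
    simpa only [h] using mul_dvd_mul hpg h2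

/-- Splitting a product according to the gcd and lcm of two divisors. -/
theorem associated_gcd_mul_div_lcm_mul [GCDMonoid F[X]] {p a b : F[X]} (hp : p ≠ 0)
    (ha : a ∣ p) (hb : b ∣ p) :
    Associated (gcd a b * (p / lcm a b) * (a / gcd a b) * (b / gcd a b)) p := by
  have hlcm := lcm_dvd ha hb
  have hg : gcd a b ≠ 0 := ne_zero_of_dvd_ne_zero (ne_zero_of_dvd_ne_zero hp ha) (gcd_dvd_left a b)
  have hl : lcm a b ≠ 0 := ne_zero_of_dvd_ne_zero hp hlcm
  have key : Associated (gcd a b * (gcd a b * (a / gcd a b) * (b / gcd a b)))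
      (gcd a b * lcm a b) := by
    have h : gcd a b * (gcd a b * (a / gcd a b) * (b / gcd a b)) = a * b := by
      rw [EuclideanDomain.mul_div_cancel' hg (gcd_dvd_left a b), mul_left_comm,
        EuclideanDomain.mul_div_cancel' hg (gcd_dvd_right a b)]
    rw [h]
    exact (gcd_mul_lcm a b).symm
  have h := (key.of_mul_left (Associated.refl _) hg).mul_right (p / lcm a b)
  rw [EuclideanDomain.mul_div_cancel' hl hlcm] at h
  rwa [mul_right_comm (gcd a b) (p / lcm a b), mul_right_comm _ (p / lcm a b)]

end ReverseLemmas

/-- `x^m - 1 = g·l·r11·t11·r22·t22` up to a nonzero scalar; moreover if `g` and `l`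
are self-reciprocal then `x^m - 1 = α·g·l·r11·t11*·r22·t22*` for some nonzero `α`,
and every irreducible factor `h` of `t22` satisfies `h* ∣ t11`. -/
theorem stmt19 (F : Type) [Field F] [Fintype F] [DecidableEq F] (m : ℕ) (hm : 0 < m)
    (hqm : Nat.Coprime (Fintype.card F) m)
    (g11 g22 : F[X]) (h11 : g11 ∣ X ^ m - 1) (h22 : g22 ∣ X ^ m - 1)
    (g l g11' g22' r11 t11 r22 t22 : F[X])
    (hg : g = gcd g11 g22) (hl : l = (X ^ m - 1) / lcm g11 g22)
    (h11' : g11' = g11 / g) (h22' : g22' = g22 / g)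
    (hr11 : r11 = gcd g11' g11'.reverse) (ht11 : t11 = g11' / r11)
    (hr22 : r22 = gcd g22' g22'.reverse) (ht22 : t22 = g22' / r22)
    :
    (∃ c : F, c ≠ 0 ∧
      X ^ m - 1 = Polynomial.C c * (g * l * r11 * t11 * r22 * t22)) ∧
    ((IsSelfReciprocal g ∧ IsSelfReciprocal l) →
      (∃ α : F, α ≠ 0 ∧
        X ^ m - 1 =
          Polynomial.C α * (g * l * r11 * t11.reverse * r22 * t22.reverse)) ∧
      ∀ h : F[X], Irreducible h → h ∣ t22 → h.reverse ∣ t11) := by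
  have hm0 : (m : F) ≠ 0 := by
    intro h
    have hu : IsCoprime (Fintype.card F : F) (m : F) := by
      simpa using (Nat.isCoprime_iff_coprime.2 hqm).map (Int.castRingHom F)
    rw [FiniteField.cast_card_eq_zero, h] at hu
    exact not_isCoprime_zero_zero hu
  have hsq : Squarefree (X ^ m - 1 : F[X]) := (X_pow_sub_one_separable_iff.2 hm0).squarefree
  have hp : (X ^ m - 1 : F[X]) ≠ 0 := hsq.ne_zero
  have hc : (X ^ m - 1 : F[X]).coeff 0 ≠ 0 := by simp [hm.ne]
  have hsplit : Associated (g * l * g11' * g22') (X ^ m - 1) := by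
    subst hg hl h11' h22'
    exact associated_gcd_mul_div_lcm_mul hp h11 h22
  have hd1 : g11' ∣ X ^ m - 1 := ((dvd_mul_left _ _).mul_right _).trans hsplit.dvd
  have hd2 : g22' ∣ X ^ m - 1 := (dvd_mul_left _ _).trans hsplit.dvd
  have hr1 : r11 ∣ g11' := hr11 ▸ gcd_dvd_left _ _
  have hr2 : r22 ∣ g22' := hr22 ▸ gcd_dvd_left _ _
  have he1 : r11 * t11 = g11' := by
    rw [ht11, EuclideanDomain.mul_div_cancel' (ne_zero_of_dvd_ne_zero hp (hr1.trans hd1)) hr1]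
  have he2 : r22 * t22 = g22' := by
    rw [ht22, EuclideanDomain.mul_div_cancel' (ne_zero_of_dvd_ne_zero hp (hr2.trans hd2)) hr2]
  have hs1 : Associated r11.reverse r11 :=
    hr11 ▸ associated_reverse_gcd_reverse (coeff_zero_ne_of_dvd hd1 hc)
  have hs2 : Associated r22.reverse r22 :=
    hr22 ▸ associated_reverse_gcd_reverse (coeff_zero_ne_of_dvd hd2 hc)
  have hfact : Associated (g * l * r11 * t11 * r22 * t22) (X ^ m - 1) := by
    rw [← he1, ← he2] at hsplit
    simpa only [mul_assoc] using hsplit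
  refine ⟨associated_iff_exists_C_mul.1 hfact, ?_⟩
  rintro ⟨hgs, hls⟩
  have hgs' : Associated g g.reverse := associated_iff_exists_C_mul.2 hgs
  have hls' : Associated l l.reverse := associated_iff_exists_C_mul.2 hls
  have hrev : Associated (g * l * r11 * t11.reverse * r22 * t22.reverse) (X ^ m - 1) := by
    have h := hfact.reverse.trans (associated_reverse_X_pow_sub_one m)
    simp only [reverse_mul_of_domain] at h
    exact (((((hgs'.mul_mul hls').mul_mul hs1.symm).mul_right _).mul_mul hs2.symm).mul_right
      _).trans h
  refine ⟨associated_iff_exists_C_mul.1 hrev, fun h _ hht => ?_⟩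
  have ht : Associated (t11.reverse * t22.reverse) (t11 * t22) := by
    have h0 : g * l * r11 * r22 ≠ 0 := by
      refine ne_zero_of_dvd_ne_zero hp (Dvd.dvd.trans ⟨t11 * t22, ?_⟩ hfact.dvd)
      ring
    refine Associated.of_mul_left ?_ (Associated.refl (g * l * r11 * r22)) h0
    have h1 : g * l * r11 * r22 * (t11.reverse * t22.reverse) =
        g * l * r11 * t11.reverse * r22 * t22.reverse := by ring
    have h2 : g * l * r11 * r22 * (t11 * t22) = g * l * r11 * t11 * r22 * t22 := by ring
    rw [h1, h2]
    exact hrev.trans hfact.symm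
  have hcop : IsCoprime t22.reverse t22 :=
    isCoprime_reverse_of_gcd_mul_eq (hsq.squarefree_of_dvd hd2) (hr22 ▸ he2)
  exact (reverse_dvd_reverse hht).trans
    (hcop.dvd_of_dvd_mul_right ((dvd_mul_left _ _).trans ht.dvd))
end
end
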